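/- arXiv:1309.2071 — 2 statements merged into one kernel-verified Lean document; each statement's English description precedes it below -/
import Mathlib

section
/- Let p ∈ 2ℕ ∪ (11,∞) and let (U,V) be a centered jointly Gaussian vector with Var(U) = 1, Var(V) = 1/3 and Cov(U,V) = 1/2. Set m_q := E[|Z|^q] for a standard normal Z. Then for all x₁, x₂, x₅ ∈ ℝ: E[ { p·sgn(x₂U)|x₂U|^{p−1} ( x₁ + (1/2) x₅ (U² − 1) ) − p m_p sgn(x₂)|x₂|^{p−1} x₅ V }² ] = p² |x₂|^{2p−2} ( x₁² m_{2p−2} + x₁ x₅ (m_{2p} − m_{2p−2}) + (x₅²/4)(m_{2p+2} − 2 m_{2p} + m_{2p−2}) + (x₅²/3) m_p² − x₅ m_p ( x₁ m_p + (x₅/2)(m_{p+2} − m_p) ) ). -/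
open MeasureTheory ProbabilityTheory Filter

/-- The absolute moment `m_q = E[|Z|^q]` of a standard normal random variable. -/
noncomputable def absMoment (q : ℝ) : ℝ :=
  ∫ x, |x| ^ q ∂(gaussianReal 0 1)

/-- The centered bivariate Gaussian measure on `ℝ²` with covariance matrix
`[[1, 1/2], [1/2, 1/3]]`, given by its density
`(√3/π)·exp(-(2u² - 6uv + 6v²))` with respect to Lebesgue measure. -/
noncomputable def biGauss : Measure (ℝ × ℝ) :=
  (volume : Measure (ℝ × ℝ)).withDensity fun x =>
    ENNReal.ofReal (Real.sqrt 3 / Real.pi *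
      Real.exp (-(2 * x.1 ^ 2 - 6 * x.1 * x.2 + 6 * x.2 ^ 2)))

theorem measurable_real_sign : Measurable Real.sign := by
  unfold Real.sign
  exact Measurable.ite measurableSet_Iio measurable_const
    (Measurable.ite measurableSet_Ioi measurable_const measurable_const)

theorem integrable_abs_rpow_gaussianReal {q : ℝ} (hq : 0 < q) :
    Integrable (fun x : ℝ => |x| ^ q) (gaussianReal 0 1) := by
  have h := (memLp_id_gaussianReal (μ := 0) (v := 1) (Real.toNNReal q)).integrable_norm_rpow
    (by simpa using hq) (by simp)
  simpa [Real.coe_toNNReal q hq.le] using h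

theorem absMoment_two : absMoment 2 = 1 := by
  have h := variance_fun_id_gaussianReal (μ := 0) (v := 1)
  rw [variance_eq_integral (by fun_prop)] at h
  simpa [absMoment] using h

theorem integral_sq_gaussianReal_zero (v : NNReal) : ∫ x, x ^ 2 ∂(gaussianReal 0 v) = v := by
  have h := variance_fun_id_gaussianReal (μ := 0) (v := v)
  rw [variance_eq_integral (by fun_prop)] at h
  simpa using h

theorem biGauss_density_eq (u w : ℝ) :
    ENNReal.ofReal (Real.sqrt 3 / Real.pi *
      Real.exp (-(2 * u ^ 2 - 6 * u * (u / 2 + w) + 6 * (u / 2 + w) ^ 2)))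
      = gaussianPDF 0 1 u * gaussianPDF 0 (1 / 12) w := by
  rw [gaussianPDF, gaussianPDF, ← ENNReal.ofReal_mul (gaussianPDFReal_nonneg _ _ _)]
  congr 1
  simp only [gaussianPDFReal]
  have hc : (√(2 * Real.pi * ((1 : NNReal) : ℝ)))⁻¹ * (√(2 * Real.pi * ((1 / 12 : NNReal) : ℝ)))⁻¹
      = √3 / Real.pi := by
    have h12 : ((1 / 12 : NNReal) : ℝ) = 1 / 12 := by norm_num
    rw [← mul_inv, ← Real.sqrt_mul (by positivity), h12, NNReal.coe_one,
      show 2 * Real.pi * 1 * (2 * Real.pi * (1 / 12)) = Real.pi ^ 2 / 3 by ring,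
      Real.sqrt_div' _ (by norm_num), Real.sqrt_sq Real.pi_pos.le, inv_div]
  rw [mul_mul_mul_comm, hc, ← Real.exp_add]
  congr 2
  push_cast
  ring

/-- If `U` and `W` are independent with laws `N(0, 1)` and `N(0, 1/12)`,
then `(U, U / 2 + W)` has law `biGauss`. -/
theorem map_prod_gaussianReal_eq_biGauss :
    Measure.map (fun z : ℝ × ℝ => (z.1, z.1 / 2 + z.2))
      ((gaussianReal 0 1).prod (gaussianReal 0 (1 / 12))) = biGauss := by
  refine Measure.ext_of_lintegral _ fun f hf => ?_
  have hg : Measurable (fun z : ℝ × ℝ => (z.1, z.1 / 2 + z.2)) := by fun_prop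
  have hfg : Measurable (fun z : ℝ × ℝ => f (z.1, z.1 / 2 + z.2)) := hf.comp hg
  have hd : Measurable fun x : ℝ × ℝ => ENNReal.ofReal (Real.sqrt 3 / Real.pi *
      Real.exp (-(2 * x.1 ^ 2 - 6 * x.1 * x.2 + 6 * x.2 ^ 2))) := by fun_prop
  rw [lintegral_map hf hg, biGauss, lintegral_withDensity_eq_lintegral_mul _ hd hf,
    Measure.volume_eq_prod, lintegral_prod _ (hd.mul hf).aemeasurable,
    lintegral_prod _ hfg.aemeasurable,
    gaussianReal_of_var_ne_zero _ one_ne_zero,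
    lintegral_withDensity_eq_lintegral_mul _ (measurable_gaussianPDF _ _)
      (Measurable.lintegral_prod_right' hfg)]
  refine lintegral_congr fun u => ?_
  rw [← lintegral_add_left_eq_self _ (u / 2), gaussianReal_of_var_ne_zero _ (by norm_num)]
  have hs : Measurable fun w => f (u, u / 2 + w) := by fun_prop
  simp only [Pi.mul_apply, biGauss_density_eq]
  rw [lintegral_withDensity_eq_lintegral_mul _ (measurable_gaussianPDF _ _) hs,
    ← lintegral_const_mul _ ((measurable_gaussianPDF _ _).mul hs)]
  simp only [Pi.mul_apply, mul_assoc]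

instance : IsProbabilityMeasure biGauss := by
  rw [← map_prod_gaussianReal_eq_biGauss]
  exact Measure.isProbabilityMeasure_map (by fun_prop)

theorem integral_sub_const_mul_sq_biGauss {A : ℝ → ℝ} (hA : Measurable A) (c : ℝ)
    (hB : Integrable (fun u => (A u - c * (u / 2)) ^ 2) (gaussianReal 0 1)) :
    ∫ x, (A x.1 - c * x.2) ^ 2 ∂biGauss
      = ∫ u, (A u - c * (u / 2)) ^ 2 ∂(gaussianReal 0 1) + c ^ 2 / 12 := by
  have hmeas : Measurable fun x : ℝ × ℝ => (A x.1 - c * x.2) ^ 2 := by fun_prop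
  rw [← map_prod_gaussianReal_eq_biGauss,
    integral_map (by fun_prop) hmeas.aestronglyMeasurable]
  have hB1 : Integrable (fun u => A u - c * (u / 2)) (gaussianReal 0 1) :=
    ((memLp_two_iff_integrable_sq (by fun_prop)).2 hB).integrable one_le_two
  have hW : MemLp (fun w : ℝ => w) 2 (gaussianReal 0 (1 / 12)) := by
    exact memLp_id_gaussianReal (μ := 0) (v := 1 / 12) 2
  have i1 := hB.mul_prod (integrable_const (μ := gaussianReal 0 (1 / 12)) (1 : ℝ))
  have i2 := hB1.mul_prod ((hW.integrable one_le_two).const_mul (-2 * c))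
  have i3 := (integrable_const (μ := gaussianReal 0 1) (1 : ℝ)).mul_prod
    (hW.integrable_sq.const_mul (c ^ 2))
  calc
    _ = ∫ z : ℝ × ℝ, ((A z.1 - c * (z.1 / 2)) ^ 2 * 1
          + (A z.1 - c * (z.1 / 2)) * (-2 * c * z.2) + 1 * (c ^ 2 * z.2 ^ 2))
          ∂((gaussianReal 0 1).prod (gaussianReal 0 (1 / 12))) := by
      congr 1 with z
      ring
    _ = _ := by
      rw [integral_add (i1.fun_add i2) i3, integral_add i1 i2,
        integral_prod_mul (fun u => (A u - c * (u / 2)) ^ 2) (fun _ => (1 : ℝ)),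
        integral_prod_mul (fun u => A u - c * (u / 2)) (fun w => -2 * c * w),
        integral_prod_mul (fun _ => (1 : ℝ)) (fun w => c ^ 2 * w ^ 2),
        integral_const_mul, integral_const_mul, integral_id_gaussianReal,
        integral_sq_gaussianReal_zero]
      simp
      ring

theorem real_sign_mul (x y : ℝ) : Real.sign (x * y) = Real.sign x * Real.sign y := by
  rcases lt_trichotomy x 0 with hx | hx | hx <;> rcases lt_trichotomy y 0 with hy | hy | hy <;>
    simp [hx, hy, Real.sign_of_neg, Real.sign_of_pos, mul_pos_of_neg_of_neg, mul_neg_of_neg_of_pos,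
      mul_neg_of_pos_of_neg]

theorem real_sign_mul_self (x : ℝ) : Real.sign x * x = |x| := by
  rcases lt_trichotomy x 0 with hx | rfl | hx
  · simp [Real.sign_of_neg hx, abs_of_neg hx]
  · simp
  · simp [Real.sign_of_pos hx, abs_of_pos hx]

theorem real_sign_sq_mul_rpow_sq {p : ℝ} (hp : 1 < p) (x : ℝ) :
    (Real.sign x * |x| ^ (p - 1)) ^ 2 = |x| ^ (2 * p - 2) := by
  rcases eq_or_ne x 0 with rfl | hx
  · rw [abs_zero, Real.zero_rpow (by linarith : 2 * p - 2 ≠ 0)]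
    simp
  · rw [mul_pow, ← Real.rpow_natCast (_ ^ _), ← Real.rpow_mul (abs_nonneg x)]
    rcases Real.sign_apply_eq_of_ne_zero x hx with h | h <;> rw [h] <;> norm_num <;> ring_nf

theorem sq_expansion_abs_rpow {p : ℝ} (hp : 1 < p) (a b d u : ℝ) :
    (Real.sign u * |u| ^ (p - 1) * (a + b * (u ^ 2 - 1)) - d * u) ^ 2
      = b ^ 2 * |u| ^ (2 * p + 2) + 2 * b * (a - b) * |u| ^ (2 * p)
        + (a - b) ^ 2 * |u| ^ (2 * p - 2) + (-2 * d * b) * |u| ^ (p + 2)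
        + (-2 * d * (a - b)) * |u| ^ p + d ^ 2 * |u| ^ (2 : ℝ) := by
  have h1 := real_sign_sq_mul_rpow_sq hp u
  have h2 : Real.sign u * |u| ^ (p - 1) * u = |u| ^ p := by
    rw [mul_right_comm, real_sign_mul_self]
    nth_rewrite 1 [← Real.rpow_one |u|]
    rw [← Real.rpow_add_of_nonneg (abs_nonneg u) zero_le_one (by linarith)]
    ring_nf
  have h3 : |u| ^ (2 : ℝ) = u ^ 2 := by simp
  have h4 : |u| ^ (2 * p) = |u| ^ (2 * p - 2) * u ^ 2 := by
    rw [← h3, ← Real.rpow_add_of_nonneg (abs_nonneg u) (by linarith) zero_le_two]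
    ring_nf
  have h5 : |u| ^ (2 * p + 2) = |u| ^ (2 * p - 2) * u ^ 2 * u ^ 2 := by
    rw [← h4, ← h3, ← Real.rpow_add_of_nonneg (abs_nonneg u) (by linarith) zero_le_two]
  have h6 : |u| ^ (p + 2) = |u| ^ p * u ^ 2 := by
    rw [← h3, ← Real.rpow_add_of_nonneg (abs_nonneg u) (by linarith) zero_le_two]
  rw [h3, h4, h5, h6, ← h1, ← h2]
  ring

theorem hasIntegral_sq_expansion_gaussianReal {p : ℝ} (hp : 1 < p) (a b d : ℝ) :
    Integrable (fun u => (Real.sign u * |u| ^ (p - 1) * (a + b * (u ^ 2 - 1)) - d * u) ^ 2)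
        (gaussianReal 0 1) ∧
      ∫ u, (Real.sign u * |u| ^ (p - 1) * (a + b * (u ^ 2 - 1)) - d * u) ^ 2 ∂(gaussianReal 0 1)
        = b ^ 2 * absMoment (2 * p + 2) + 2 * b * (a - b) * absMoment (2 * p)
          + (a - b) ^ 2 * absMoment (2 * p - 2) + (-2 * d * b) * absMoment (p + 2)
          + (-2 * d * (a - b)) * absMoment p + d ^ 2 := by
  simp only [sq_expansion_abs_rpow hp]
  have i1 := (integrable_abs_rpow_gaussianReal (by linarith : 0 < 2 * p + 2)).const_mul (b ^ 2)
  have i2 := (integrable_abs_rpow_gaussianReal (by linarith : 0 < 2 * p)).const_mul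
    (2 * b * (a - b))
  have i3 := (integrable_abs_rpow_gaussianReal (by linarith : 0 < 2 * p - 2)).const_mul
    ((a - b) ^ 2)
  have i4 := (integrable_abs_rpow_gaussianReal (by linarith : 0 < p + 2)).const_mul (-2 * d * b)
  have i5 := (integrable_abs_rpow_gaussianReal (by linarith : 0 < p)).const_mul
    (-2 * d * (a - b))
  have i6 := (integrable_abs_rpow_gaussianReal (zero_lt_two (α := ℝ))).const_mul (d ^ 2)
  refine ⟨((((i1.fun_add i2).fun_add i3).fun_add i4).fun_add i5).fun_add i6, ?_⟩
  rw [integral_add ((((i1.fun_add i2).fun_add i3).fun_add i4).fun_add i5) i6,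
    integral_add (((i1.fun_add i2).fun_add i3).fun_add i4) i5, integral_add ((i1.fun_add i2).fun_add i3) i4,
    integral_add (i1.fun_add i2) i3, integral_add i1 i2]
  simp only [integral_const_mul]
  change _ + d ^ 2 * absMoment 2 = _
  rw [absMoment_two, mul_one]
  rfl

/-- For `p ∈ 2ℕ ∪ (11,∞)` and `(U,V)` centered jointly Gaussian with `Var(U)=1`,
`Var(V)=1/3`, `Cov(U,V)=1/2`, the second moment
`E[{p sgn(x₂U)|x₂U|^{p-1}(x₁ + ½x₅(U²-1)) - p m_p sgn(x₂)|x₂|^{p-1} x₅ V}²]` equals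
`p²|x₂|^{2p-2}(x₁² m_{2p-2} + x₁x₅(m_{2p} - m_{2p-2}) + (x₅²/4)(m_{2p+2} - 2m_{2p} + m_{2p-2})
 + (x₅²/3)m_p² - x₅ m_p (x₁ m_p + (x₅/2)(m_{p+2} - m_p)))`. -/
theorem statement10 (p : ℝ)
    (hp : (∃ m : ℕ, 0 < m ∧ p = 2 * m) ∨ 11 < p)
    {Ω : Type*} {mΩ : MeasurableSpace Ω} (μ : Measure Ω) [IsProbabilityMeasure μ]
    (U V : Ω → ℝ)
    (hUV : Measure.map (fun ω => (U ω, V ω)) μ = biGauss)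
    (x₁ x₂ x₅ : ℝ) :
    ∫ ω,
        (p * Real.sign (x₂ * U ω) * |x₂ * U ω| ^ (p - 1)
            * (x₁ + (1 / 2) * x₅ * ((U ω) ^ 2 - 1))
          - p * absMoment p * Real.sign x₂ * |x₂| ^ (p - 1) * x₅ * V ω) ^ 2 ∂μ
      = p ^ 2 * |x₂| ^ (2 * p - 2)
          * (x₁ ^ 2 * absMoment (2 * p - 2)
            + x₁ * x₅ * (absMoment (2 * p) - absMoment (2 * p - 2))
            + (x₅ ^ 2 / 4)
              * (absMoment (2 * p + 2) - 2 * absMoment (2 * p) + absMoment (2 * p - 2))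
            + (x₅ ^ 2 / 3) * (absMoment p) ^ 2
            - x₅ * absMoment p
              * (x₁ * absMoment p + (x₅ / 2) * (absMoment (p + 2) - absMoment p))) := by
  have hp1 : 1 < p := by
    rcases hp with ⟨m, hm, rfl⟩ | h
    · have : (1 : ℝ) ≤ m := by exact_mod_cast hm
      linarith
    · linarith
  have hm : AEMeasurable (fun ω => (U ω, V ω)) μ := by
    by_contra h
    rw [Measure.map_of_not_aemeasurable h] at hUV
    exact IsProbabilityMeasure.ne_zero biGauss hUV.symm
  set M := absMoment p
  set K := p * (Real.sign x₂ * |x₂| ^ (p - 1)) with hK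
  have hK2 : K ^ 2 = p ^ 2 * |x₂| ^ (2 * p - 2) := by
    rw [hK, mul_pow, real_sign_sq_mul_rpow_sq hp1]
  let g : ℝ → ℝ := fun u => Real.sign u * |u| ^ (p - 1) * (x₁ + x₅ / 2 * (u ^ 2 - 1))
  have hg : Measurable g := by
    have := measurable_real_sign
    fun_prop
  have hB : ∀ u, (K * g u - K * M * x₅ * (u / 2)) ^ 2
      = K ^ 2 * (Real.sign u * |u| ^ (p - 1) * (x₁ + x₅ / 2 * (u ^ 2 - 1))
        - M * x₅ / 2 * u) ^ 2 := fun u => by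
    ring
  obtain ⟨hI, hE⟩ := hasIntegral_sq_expansion_gaussianReal hp1 x₁ (x₅ / 2) (M * x₅ / 2)
  have key := integral_sub_const_mul_sq_biGauss (hg.const_mul K) (K * M * x₅)
    (by simpa only [hB] using hI.const_mul (K ^ 2))
  simp only [hB] at key
  rw [integral_const_mul, hE] at key
  have hF : Measurable fun x : ℝ × ℝ => (K * g x.1 - K * M * x₅ * x.2) ^ 2 := by fun_prop
  rw [← hUV, integral_map hm hF.aestronglyMeasurable] at key
  rw [← hK2]
  refine Eq.trans (integral_congr_ae (.of_forall fun ω => ?_)) (key.trans ?_)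
  · simp only [g, hK, real_sign_mul, abs_mul, Real.mul_rpow (abs_nonneg x₂) (abs_nonneg (U ω))]
    ring
  · ring
end

section
/- Let g : ℝ → ℝ be a polynomial and let κ : ℝ → ℝ be a C² function vanishing outside [ε₀, ∞) for some ε₀ > 0 and decaying, together with its derivatives, faster than any polynomial at infinity. Then ∫_0^∞ ∫_ℝ g(z/√x) · ∂_z² [ z · φ(z;0,x) κ(x) ] dz dx = ( ∫_0^∞ x^{−1/2} κ(x) dx ) · ( ∫_ℝ g(y) (y³ − 3y) φ(y;0,1) dy ), where φ(z;0,x) = (2πx)^{−1/2} exp(−z²/(2x)). In particular this uses the identity (d²/dy²)[ y φ(y;0,1) ] = (y³ − 3y) φ(y;0,1). -/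
open MeasureTheory Filter

/-- The centered normal density `φ(z;0,x) = (2πx)^{-1/2} exp(-z²/(2x))`. -/
noncomputable def normDens (z x : ℝ) : ℝ :=
  (Real.sqrt (2 * Real.pi * x))⁻¹ * Real.exp (-(z ^ 2) / (2 * x))

theorem hasDerivAt_normDens (x z : ℝ) :
    HasDerivAt (fun z => normDens z x) (-(z / x) * normDens z x) z := by
  have h : HasDerivAt (fun z : ℝ => -(z ^ 2) / (2 * x)) (-(z / x)) z := by
    refine (((hasDerivAt_id z).pow 2).neg.div_const (2 * x)).congr_deriv ?_
    by_cases hx : x = 0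
    · simp [hx]
    · simp only [id, Nat.cast_ofNat, Nat.add_one_sub_one, pow_one, mul_one]
      field_simp
  unfold normDens
  refine (h.exp.const_mul _).congr_deriv ?_
  ring

theorem iteratedDeriv_two_id_mul_normDens_mul (x k z : ℝ) :
    iteratedDeriv 2 (fun z => z * normDens z x * k) z
      = (z ^ 3 / x ^ 2 - 3 * (z / x)) * normDens z x * k := by
  have h₁ : deriv (fun z => z * normDens z x * k)
      = fun z => (1 - z ^ 2 / x) * normDens z x * k := by
    funext w
    refine ((((hasDerivAt_id w).mul (hasDerivAt_normDens x w)).mul_const k).congr_deriv ?_).deriv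
    simp only [id]
    ring
  rw [iteratedDeriv_succ, iteratedDeriv_one, h₁]
  have h₂ : HasDerivAt (fun z : ℝ => 1 - z ^ 2 / x) (-(2 * z / x)) z := by
    refine ((((hasDerivAt_id z).pow 2).div_const x).const_sub 1).congr_deriv ?_
    simp
  refine (((h₂.mul (hasDerivAt_normDens x z)).mul_const k).congr_deriv ?_).deriv
  ring

theorem normDens_eq_inv_sqrt_mul {x : ℝ} (hx : 0 < x) (z : ℝ) :
    normDens z x = (√x)⁻¹ * normDens (z / √x) 1 := by
  unfold normDens
  rw [Real.sqrt_mul (by positivity), div_pow, Real.sq_sqrt hx.le, mul_inv]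
  have h : -(z ^ 2) / (2 * x) = -(z ^ 2 / x) / (2 * 1) := by field_simp
  rw [h, mul_one (2 * Real.pi)]
  ring

theorem integral_comp_div_sqrt_mul_iteratedDeriv_two (g : ℝ → ℝ) (k : ℝ) {x : ℝ} (hx : 0 < x) :
    ∫ z, g (z / √x) * iteratedDeriv 2 (fun z => z * normDens z x * k) z
      = x ^ (-(1:ℝ) / 2) * k * ∫ y, g y * (y ^ 3 - 3 * y) * normDens y 1 := by
  have hs : 0 < √x := Real.sqrt_pos.2 hx
  have hpow : x ^ (-(1:ℝ) / 2) = (√x)⁻¹ := by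
    rw [neg_div, Real.rpow_neg hx.le, Real.sqrt_eq_rpow]
  have key : ∀ z, g (z / √x) * iteratedDeriv 2 (fun z => z * normDens z x * k) z
      = (fun y => (√x)⁻¹ ^ 2 * k * (g y * (y ^ 3 - 3 * y) * normDens y 1)) (z / √x) := by
    intro z
    rw [iteratedDeriv_two_id_mul_normDens_mul, normDens_eq_inv_sqrt_mul hx]
    have hc : z ^ 3 / x ^ 2 - 3 * (z / x) = (√x)⁻¹ * ((z / √x) ^ 3 - 3 * (z / √x)) := by
      obtain ⟨s, hs', rfl⟩ : ∃ s, 0 < s ∧ x = s ^ 2 := ⟨√x, hs, (Real.sq_sqrt hx.le).symm⟩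
      rw [Real.sqrt_sq hs'.le]
      field_simp
    rw [hc]
    ring
  rw [funext key,
    Measure.integral_comp_div (fun y => (√x)⁻¹ ^ 2 * k * (g y * (y ^ 3 - 3 * y) * normDens y 1)),
    integral_const_mul, abs_of_pos hs, hpow, smul_eq_mul]
  field_simp

/-- For a polynomial `g` and a `C²` function `κ` vanishing outside `[ε₀,∞)` (`ε₀ > 0`) and
rapidly decaying together with its derivatives,
`∫_0^∞ ∫_ℝ g(z/√x) ∂_z²[z φ(z;0,x)κ(x)] dz dx
 = (∫_0^∞ x^{-1/2} κ(x) dx)(∫_ℝ g(y)(y³ - 3y) φ(y;0,1) dy)`;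
this uses the identity `(d²/dy²)[y φ(y;0,1)] = (y³ - 3y) φ(y;0,1)`. -/
theorem statement13 (P : Polynomial ℝ) (κ : ℝ → ℝ) (ε₀ : ℝ) (hε₀ : 0 < ε₀)
    (hκsupp : ∀ x < ε₀, κ x = 0)
    (hκC2 : ContDiff ℝ 2 κ)
    (hκdecay : ∀ j ≤ 2, ∀ q : ℕ,
      Tendsto (fun x => x ^ q * iteratedDeriv j κ x) atTop (nhds 0)) :
    (∫ x in Set.Ioi (0:ℝ),
        (∫ z, P.eval (z / Real.sqrt x)
          * iteratedDeriv 2 (fun z' => z' * normDens z' x * κ x) z)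
      = (∫ x in Set.Ioi (0:ℝ), x ^ (-(1:ℝ)/2) * κ x)
          * ∫ y, P.eval y * (y ^ 3 - 3 * y) * normDens y 1)
    ∧ (∀ y : ℝ, iteratedDeriv 2 (fun y' => y' * normDens y' 1) y
        = (y ^ 3 - 3 * y) * normDens y 1) := by
  refine ⟨?_, fun y => ?_⟩
  · rw [← integral_mul_const]
    exact setIntegral_congr_fun measurableSet_Ioi fun x hx =>
      integral_comp_div_sqrt_mul_iteratedDeriv_two (fun y => P.eval y) (κ x) hx
  · simpa using iteratedDeriv_two_id_mul_normDens_mul 1 1 y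
end
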